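/- Let τ lie in the complex upper half-plane and let σ = −1 + √2. Then v(τ)² + v(−1/(8τ))² = σ²·(1 + v(τ)²·v(−1/(8τ))²); that is, the pair (X, Y) = (v(τ), v(−1/(8τ))) is a point on the curve C₂ : X² + Y² = σ²(1 + X²Y²). -/

import Mathlib

/-- `qpow τ r = exp(2πi·r·τ)`, i.e. `q^r` where `q = exp(2πiτ)`. -/
noncomputable def qpow (τ : ℂ) (r : ℝ) : ℂ :=
  Complex.exp (2 * (Real.pi : ℂ) * Complex.I * (r : ℂ) * τ)

/-- The Kronecker symbol `(2/n)`: `+1` if `n ≡ ±1 (mod 8)`, `-1` if `n ≡ ±3 (mod 8)`,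
`0` if `n` is even. -/
def chi8 (n : ℕ) : ℤ :=
  if n % 8 = 1 ∨ n % 8 = 7 then 1 else if n % 8 = 3 ∨ n % 8 = 5 then -1 else 0

/-- Ramanujan's continued fraction value
`v(τ) = q^{1/2} ∏_{n≥1} (1 - q^n)^{χ₈(n)}`, `q = exp(2πiτ)`. -/
noncomputable def vRam (τ : ℂ) : ℂ :=
  qpow τ (1/2) * ∏' n : ℕ, (1 - qpow τ ((n : ℝ) + 1)) ^ chi8 (n + 1)

open Filter Topology Finset

/-- The reciprocal `1 / (q; q)_m` of the finite `q`-Pochhammer symbol, extended by `0` to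
negative `m`. -/
noncomputable def qFactorialInv (q : ℂ) (m : ℤ) : ℂ :=
  if 0 ≤ m then (∏ k ∈ range m.toNat, (1 - q ^ (k + 1)))⁻¹ else 0

/-- The infinite `q`-Pochhammer symbol `(a; q)_∞`. -/
noncomputable def qPochhammer (a q : ℂ) : ℂ := ∏' k : ℕ, (1 - a * q ^ k)

/-- The two-variable theta series `∑ q ^ (j ^ 2) * z ^ j` over the integers. -/
noncomputable def thetaSeries (q z : ℂ) : ℂ := ∑' j : ℤ, q ^ (j ^ 2) * z ^ j

theorem one_sub_pow_succ_ne_zero {q : ℂ} (hq : ‖q‖ < 1) (k : ℕ) : 1 - q ^ (k + 1) ≠ 0 := by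
  intro h
  have h1 : ‖q ^ (k + 1)‖ = 1 := by rw [← sub_eq_zero.mp h, norm_one]
  rw [norm_pow] at h1
  exact (pow_lt_one₀ (norm_nonneg q) hq k.succ_ne_zero).ne h1

theorem qFactorialInv_natCast (q : ℂ) (n : ℕ) :
    qFactorialInv q n = (∏ k ∈ range n, (1 - q ^ (k + 1)))⁻¹ := by
  simp [qFactorialInv]

theorem qFactorialInv_of_neg (q : ℂ) {m : ℤ} (hm : m < 0) : qFactorialInv q m = 0 := by
  simp [qFactorialInv, hm]

theorem qFactorialInv_eq_succ {q : ℂ} (hq : ‖q‖ < 1) (m : ℤ) :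
    qFactorialInv q m = (1 - q ^ (m + 1)) * qFactorialInv q (m + 1) := by
  rcases lt_trichotomy m (-1) with h | rfl | h
  · rw [qFactorialInv_of_neg q (by omega), qFactorialInv_of_neg q (by omega), mul_zero]
  · simp [qFactorialInv]
  · lift m to ℕ using by omega
    have := one_sub_pow_succ_ne_zero hq m
    norm_cast
    rw [qFactorialInv_natCast, qFactorialInv_natCast, prod_range_succ, mul_inv]
    field_simp

/-- The finite form of the Jacobi triple product identity. -/
theorem hasSum_finite_tripleProduct {q z : ℂ} (hq : ‖q‖ < 1) (hq0 : q ≠ 0) (hz : z ≠ 0) (n : ℕ) :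
    HasSum (fun j : ℤ ↦ q ^ (j ^ 2) * z ^ j *
        (qFactorialInv (q ^ 2) (n + j) * qFactorialInv (q ^ 2) (n - j)))
      ((∏ k ∈ range n, ((1 + z * q ^ (2 * k + 1)) * (1 + z⁻¹ * q ^ (2 * k + 1)))) *
        qFactorialInv (q ^ 2) (2 * n : ℕ)) := by
  have hQ : ‖q ^ 2‖ < 1 := by
    rw [norm_pow]; exact pow_lt_one₀ (norm_nonneg q) hq two_ne_zero
  induction n with
  | zero =>
    have h := hasSum_single (f := fun j : ℤ ↦ q ^ (j ^ 2) * z ^ j *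
        (qFactorialInv (q ^ 2) ((0 : ℕ) + j) * qFactorialInv (q ^ 2) ((0 : ℕ) - j))) 0 ?_
    · simpa [qFactorialInv] using h
    · intro j hj
      rcases lt_or_gt_of_ne hj with h | h
      · rw [qFactorialInv_of_neg _ (m := (0 : ℕ) + j) (by simpa using h), zero_mul, mul_zero]
      · rw [qFactorialInv_of_neg _ (m := (0 : ℕ) - j) (by simpa using h), mul_zero, mul_zero]
  | succ n ih =>
    have hm := (Equiv.subRight (1 : ℤ)).hasSum_iff.mpr ih
    have hp := (Equiv.addRight (1 : ℤ)).hasSum_iff.mpr ih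
    have h1 := one_sub_pow_succ_ne_zero hQ (2 * n)
    have h2 := one_sub_pow_succ_ne_zero hQ (2 * n + 1)
    have key := (((ih.mul_left (1 + q ^ (2 * (2 * n + 1)))).add
      (hm.mul_left (q ^ (2 * n + 1) * z))).add (hp.mul_left (q ^ (2 * n + 1) * z⁻¹))).mul_left
      (((1 - (q ^ 2) ^ (2 * n + 1)) * (1 - (q ^ 2) ^ (2 * n + 1 + 1)))⁻¹)
    convert! key using 1
    · funext j
      simp only [Function.comp_apply, Equiv.subRight_apply, Equiv.coe_addRight]
      rw [eq_inv_mul_iff_mul_eq₀ (mul_ne_zero h1 h2)]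
      have e1 := qFactorialInv_eq_succ hQ (n + j)
      have e2 := qFactorialInv_eq_succ hQ (n - j)
      have e3 := qFactorialInv_eq_succ hQ (n + (j - 1))
      have e4 := qFactorialInv_eq_succ hQ (n - (j + 1))
      rw [show (n : ℤ) + (j - 1) + 1 = n + j by ring, e1] at e3
      rw [show (n : ℤ) - (j + 1) + 1 = n - j by ring, e2] at e4
      rw [e1, e2, e3, e4, show ((n + 1 : ℕ) : ℤ) + j = n + j + 1 by push_cast; ring,
        show ((n + 1 : ℕ) : ℤ) - j = n - j + 1 by push_cast; ring,
        show (n : ℤ) - (j - 1) = n - j + 1 by ring, show (n : ℤ) + (j + 1) = n + j + 1 by ring]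
      generalize qFactorialInv (q ^ 2) (n + j + 1) = a
      generalize qFactorialInv (q ^ 2) (n - j + 1) = b
      have s1 : q ^ ((j - 1) ^ 2) = q ^ (j ^ 2) * q * (q ^ j)⁻¹ ^ 2 := by
        rw [show (j - 1) ^ 2 = j ^ 2 + 1 + (-j) * 2 by ring, zpow_add₀ hq0, zpow_add₀ hq0,
          zpow_mul, zpow_neg, zpow_one]; norm_cast
      have s2 : q ^ ((j + 1) ^ 2) = q ^ (j ^ 2) * q * (q ^ j) ^ 2 := by
        rw [show (j + 1) ^ 2 = j ^ 2 + 1 + j * 2 by ring, zpow_add₀ hq0, zpow_add₀ hq0,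
          zpow_mul, zpow_one]; norm_cast
      have hzj : z ^ j ≠ 0 := zpow_ne_zero _ hz
      have hqj : q ^ j ≠ 0 := zpow_ne_zero _ hq0
      have hQz : ∀ k : ℤ, (q ^ 2) ^ k = (q ^ k) ^ 2 := fun k ↦ by
        rw [← zpow_natCast, ← zpow_mul, mul_comm, zpow_mul, zpow_natCast]
      rw [s1, s2, zpow_sub_one₀ hz, zpow_add_one₀ hz]
      simp only [hQz, zpow_add₀ hq0, zpow_sub₀ hq0, zpow_one, zpow_natCast]
      generalize q ^ (j ^ 2) = c
      have hqn : q ^ n ≠ 0 := pow_ne_zero _ hq0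
      rw [show (q ^ 2) ^ (2 * n + 1) = (q ^ n) ^ 4 * q ^ 2 by ring,
        show (q ^ 2) ^ (2 * n + 1 + 1) = (q ^ n) ^ 4 * q ^ 4 by ring,
        show q ^ (2 * (2 * n + 1)) = (q ^ n) ^ 4 * q ^ 2 by ring,
        show q ^ (2 * n + 1) = (q ^ n) ^ 2 * q by ring]
      generalize q ^ n = u at *
      generalize q ^ j = w at *
      field_simp
      ring
    · rw [prod_range_succ, show 2 * (n + 1) = 2 * n + 1 + 1 by ring, qFactorialInv_natCast,
        qFactorialInv_natCast, prod_range_succ, prod_range_succ, mul_inv, mul_inv]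
      field_simp
      ring

theorem summable_norm_thetaSeries {q z : ℂ} (hq : ‖q‖ < 1) (hq0 : q ≠ 0) (hz : z ≠ 0) :
    Summable fun j : ℤ ↦ ‖q ^ (j ^ 2) * z ^ j‖ := by
  have hπ : (Real.pi : ℂ) * Complex.I ≠ 0 := by simp [Real.pi_ne_zero]
  set τ : ℂ := Complex.log q / (Real.pi * Complex.I) with hτ_def
  set w : ℂ := Complex.log z / (2 * (Real.pi * Complex.I)) with hw_def
  have hτq : Complex.exp (Real.pi * Complex.I * τ) = q := by
    rw [hτ_def, mul_div_cancel₀ _ hπ, Complex.exp_log hq0]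
  have hwz : Complex.exp (2 * (Real.pi * Complex.I) * w) = z := by
    rw [hw_def, mul_div_cancel₀ _ (mul_ne_zero two_ne_zero hπ), Complex.exp_log hz]
  have hτ : 0 < τ.im := by
    rw [← hτq, Complex.norm_exp, Real.exp_lt_one_iff] at hq
    simp only [Complex.mul_re, Complex.ofReal_re, Complex.I_re, mul_zero, Complex.ofReal_im,
      Complex.I_im, mul_one, sub_self, zero_mul, Complex.mul_im, add_zero, zero_sub] at hq
    have := Real.pi_pos
    nlinarith
  refine (((summable_jacobiTheta₂_term_iff w τ).mpr hτ).congr fun j ↦ ?_).norm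
  rw [jacobiTheta₂_term, ← hτq, ← hwz, ← Complex.exp_int_mul, ← Complex.exp_int_mul,
    ← Complex.exp_add]
  push_cast
  ring_nf

theorem summable_norm_mul_pow (a : ℂ) {q : ℂ} (hq : ‖q‖ < 1) :
    Summable fun k : ℕ ↦ ‖-(a * q ^ k)‖ := by
  simpa using (summable_geometric_of_lt_one (norm_nonneg q) hq).mul_left ‖a‖

theorem hasProd_qPochhammer (a : ℂ) {q : ℂ} (hq : ‖q‖ < 1) :
    HasProd (fun k : ℕ ↦ 1 - a * q ^ k) (qPochhammer a q) := by
  have h := multipliable_one_add_of_summable (summable_norm_mul_pow a hq)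
  simp only [← sub_eq_add_neg] at h
  exact h.hasProd

theorem qPochhammer_ne_zero {a q : ℂ} (ha : ‖a‖ < 1) (hq : ‖q‖ < 1) : qPochhammer a q ≠ 0 := by
  have h := tprod_one_add_ne_zero_of_summable (fun k h ↦ ?_) (summable_norm_mul_pow a hq)
  · simpa only [qPochhammer, sub_eq_add_neg] using h
  · have h1 : ‖a * q ^ k‖ = 1 := by
      rw [← sub_eq_zero.mp ((sub_eq_add_neg _ _).trans h), norm_one]
    rw [norm_mul, norm_pow] at h1
    exact (mul_lt_one_of_nonneg_of_lt_one_left (norm_nonneg a) ha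
      (pow_le_one₀ (norm_nonneg q) hq.le)).ne h1

theorem tendsto_qFactorialInv {q : ℂ} (hq : ‖q‖ < 1) :
    Tendsto (qFactorialInv q) atTop (𝓝 (qPochhammer q q)⁻¹) := by
  rw [← Nat.map_cast_int_atTop, tendsto_map'_iff]
  refine ((hasProd_qPochhammer q hq).tendsto_prod_nat.inv₀ (qPochhammer_ne_zero hq hq)).congr
    fun n ↦ ?_
  simp only [Function.comp_apply, qFactorialInv_natCast, pow_succ']

theorem exists_norm_qFactorialInv_le {q : ℂ} (hq : ‖q‖ < 1) :
    ∃ C, ∀ m, ‖qFactorialInv q m‖ ≤ C := by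
  have h := ((tendsto_qFactorialInv hq).comp (tendsto_natCast_atTop_atTop (R := ℤ))).norm
  obtain ⟨C, hC⟩ := h.bddAbove_range
  have hCnat : ∀ n : ℕ, ‖qFactorialInv q n‖ ≤ C := fun n ↦ hC ⟨n, rfl⟩
  refine ⟨C, fun m ↦ ?_⟩
  rcases lt_or_ge m 0 with hm | hm
  · rw [qFactorialInv_of_neg q hm, norm_zero]
    exact (norm_nonneg _).trans (hCnat 0)
  · lift m to ℕ using hm
    exact hCnat m

/-- The Jacobi triple product identity. -/
theorem thetaSeries_eq_mul {q z : ℂ} (hq : ‖q‖ < 1) (hq0 : q ≠ 0) (hz : z ≠ 0) :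
    thetaSeries q z = qPochhammer (q ^ 2) (q ^ 2) *
      (qPochhammer (-(z * q)) (q ^ 2) * qPochhammer (-(z⁻¹ * q)) (q ^ 2)) := by
  have hQ : ‖q ^ 2‖ < 1 := by
    rw [norm_pow]; exact pow_lt_one₀ (norm_nonneg q) hq two_ne_zero
  have hne := qPochhammer_ne_zero hQ hQ
  obtain ⟨C, hC⟩ := exists_norm_qFactorialInv_le hQ
  have hlim := tendsto_qFactorialInv hQ
  have hcast := tendsto_natCast_atTop_atTop (R := ℤ)
  have hsum := tendsto_tsum_of_dominated_convergence (𝓕 := atTop)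
    (f := fun (n : ℕ) (j : ℤ) ↦ q ^ (j ^ 2) * z ^ j *
      (qFactorialInv (q ^ 2) (n + j) * qFactorialInv (q ^ 2) (n - j)))
    (g := fun j ↦ q ^ (j ^ 2) * z ^ j *
      ((qPochhammer (q ^ 2) (q ^ 2))⁻¹ * (qPochhammer (q ^ 2) (q ^ 2))⁻¹))
    ((summable_norm_thetaSeries hq hq0 hz).mul_right (C * C))
    (fun j ↦ ((hlim.comp (tendsto_atTop_add_const_right _ j hcast)).mul
      (hlim.comp (tendsto_atTop_add_const_right _ (-j) hcast))).const_mul _)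
    (.of_forall fun n j ↦ by
      rw [norm_mul _ (_ * _), norm_mul (qFactorialInv _ _)]
      gcongr
      · exact (norm_nonneg _).trans (hC 0)
      · exact hC _
      · exact hC _)
  simp only [(hasSum_finite_tripleProduct hq hq0 hz _).tsum_eq, tsum_mul_right] at hsum
  have h1 := (hasProd_qPochhammer (-(z * q)) hQ).tendsto_prod_nat
  have h2 := (hasProd_qPochhammer (-(z⁻¹ * q)) hQ).tendsto_prod_nat
  have h3 := hlim.comp (hcast.comp (tendsto_id.const_mul_atTop' two_pos))
  have heq := tendsto_nhds_unique hsum (((h1.mul h2).mul h3).congr fun n ↦ ?_)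
  · rw [thetaSeries]
    generalize qPochhammer (-(z * q)) (q ^ 2) = A, qPochhammer (-(z⁻¹ * q)) (q ^ 2) = B at heq ⊢
    field_simp at heq
    linear_combination heq
  · rw [prod_mul_distrib]
    simp only [Function.comp_apply, id_eq]
    congr 2 <;> refine prod_congr rfl fun k _ ↦ ?_ <;> ring

theorem thetaSeries_sq_mul {p z : ℂ} (hp0 : p ≠ 0) (hz : z ≠ 0) :
    thetaSeries p (p ^ 2 * z) = p⁻¹ * z⁻¹ * thetaSeries p z⁻¹ := by
  rw [thetaSeries, ← ((Equiv.addRight (1 : ℤ)).trans (Equiv.neg ℤ)).tsum_eq, thetaSeries,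
    ← tsum_mul_left]
  refine tsum_congr fun j ↦ ?_
  have h : p ^ ((j + 1) ^ 2) = p ^ (j ^ 2) * (p ^ j) ^ 2 * p := by
    rw [show (j + 1) ^ 2 = j ^ 2 + j * 2 + 1 by ring, zpow_add₀ hp0, zpow_add₀ hp0,
      zpow_mul, zpow_one]
    norm_cast
  have hpj := zpow_ne_zero j hp0
  have hzj := zpow_ne_zero j hz
  simp only [Equiv.trans_apply, Equiv.coe_addRight, Equiv.neg_apply, neg_sq, h, zpow_neg,
    mul_zpow, zpow_add_one₀ hz, inv_zpow, zpow_add_one₀ (pow_ne_zero 2 hp0)]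
  rw [show (p ^ 2) ^ j = (p ^ j) ^ 2 by rw [← zpow_natCast, ← zpow_mul, mul_comm, zpow_mul,
    zpow_natCast]]
  field_simp

/-- A double series over `ℤ × ℤ` splits according to whether the two indices have the same
parity. -/
theorem hasSum_int_prod_of_parity {f : ℤ × ℤ → ℂ} {a b : ℂ}
    (ha : HasSum (fun x : ℤ × ℤ ↦ f (x.1 + x.2, x.1 - x.2)) a)
    (hb : HasSum (fun x : ℤ × ℤ ↦ f (x.1 + x.2 + 1, x.1 - x.2)) b) : HasSum f (a + b) := by
  have h1 : Function.Injective fun x : ℤ × ℤ ↦ (x.1 + x.2, x.1 - x.2) := fun x y h ↦ by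
    simp only [Prod.mk.injEq] at h
    ext <;> omega
  have h2 : Function.Injective fun x : ℤ × ℤ ↦ (x.1 + x.2 + 1, x.1 - x.2) := fun x y h ↦ by
    simp only [Prod.mk.injEq] at h
    ext <;> omega
  refine (h1.hasSum_range_iff.mpr ha).add_isCompl ?_ (h2.hasSum_range_iff.mpr hb)
  rw [isCompl_iff, Set.disjoint_left, codisjoint_iff_le_sup]
  constructor
  · rintro _ ⟨u, rfl⟩ ⟨v, h⟩
    simp only [Prod.mk.injEq] at h
    omega
  · rintro ⟨s, d⟩ -
    rcases Int.even_or_odd' (s + d) with ⟨m, hm | hm⟩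
    · exact Or.inl ⟨(m, m - d), by ext <;> simp only <;> omega⟩
    · exact Or.inr ⟨(m, m - d), by ext <;> simp only <;> omega⟩

/-- The addition formula for products of two theta series. -/
theorem thetaSeries_mul_thetaSeries {p x y : ℂ} (hp : ‖p‖ < 1) (hp0 : p ≠ 0) (hx : x ≠ 0)
    (hy : y ≠ 0) :
    thetaSeries p x * thetaSeries p y =
      thetaSeries (p ^ 2) (x * y) * thetaSeries (p ^ 2) (x * y⁻¹) +
        p * x * (thetaSeries (p ^ 2) ((p ^ 2) * (x * y)) *
          thetaSeries (p ^ 2) ((p ^ 2) * (x * y⁻¹))) := by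
  have hp2 : ‖p ^ 2‖ < 1 := by
    rw [norm_pow]; exact pow_lt_one₀ (norm_nonneg p) hp two_ne_zero
  have hp20 : p ^ 2 ≠ 0 := pow_ne_zero 2 hp0
  have hasSum_mul {r u v : ℂ} (hr : ‖r‖ < 1) (hr0 : r ≠ 0) (hu : u ≠ 0) (hv : v ≠ 0) :
      HasSum (fun m : ℤ × ℤ ↦ r ^ (m.1 ^ 2) * u ^ m.1 * (r ^ (m.2 ^ 2) * v ^ m.2))
        (thetaSeries r u * thetaSeries r v) := by
    have h1 := summable_norm_thetaSeries hr hr0 hu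
    have h2 := summable_norm_thetaSeries hr hr0 hv
    rw [thetaSeries, thetaSeries, tsum_mul_tsum_of_summable_norm h1 h2]
    exact (summable_mul_of_summable_norm h1 h2).hasSum
  refine (hasSum_mul hp hp0 hx hy).unique (hasSum_int_prod_of_parity ?_ ?_)
  · convert! hasSum_mul hp2 hp20 (mul_ne_zero hx hy) (mul_ne_zero hx (inv_ne_zero hy)) using 2
      with m
    rw [mul_mul_mul_comm, mul_mul_mul_comm ((p ^ 2) ^ _), ← zpow_add₀ hp0, ← zpow_add₀ hp20,
      ← zpow_natCast, ← zpow_mul, zpow_add₀ hx, zpow_sub₀ hy, mul_zpow, mul_zpow, inv_zpow]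
    ring_nf
  · convert! (hasSum_mul hp2 hp20 (mul_ne_zero hp20 (mul_ne_zero hx hy))
      (mul_ne_zero hp20 (mul_ne_zero hx (inv_ne_zero hy)))).mul_left (p * x) using 2 with m
    have h : p ^ ((m.1 + m.2 + 1) ^ 2) * p ^ ((m.1 - m.2) ^ 2) =
        p * ((p ^ 2) ^ (m.1 ^ 2) * (p ^ 2) ^ (m.2 ^ 2) * ((p ^ 2) ^ m.1 * (p ^ 2) ^ m.2)) := by
      simp only [← zpow_add₀ hp0, ← zpow_add₀ hp20]
      rw [← zpow_natCast, ← zpow_mul, ← zpow_one_add₀ hp0]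
      ring_nf
    rw [mul_mul_mul_comm, h, zpow_add_one₀ hx, zpow_add₀ hx, zpow_sub₀ hy, mul_zpow, mul_zpow,
      mul_zpow, mul_zpow, inv_zpow]
    ring

theorem qPochhammer_eq_mul (a : ℂ) {q : ℂ} (hq : ‖q‖ < 1) :
    qPochhammer a q = qPochhammer a (q ^ 2) * qPochhammer (a * q) (q ^ 2) := by
  have hQ : ‖q ^ 2‖ < 1 := by
    rw [norm_pow]; exact pow_lt_one₀ (norm_nonneg q) hq two_ne_zero
  refine (hasProd_qPochhammer a hq).unique (HasProd.even_mul_odd ?_ ?_)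
  · simpa only [pow_mul] using hasProd_qPochhammer a hQ
  · simpa only [pow_succ', pow_mul, mul_assoc] using hasProd_qPochhammer (a * q) hQ

theorem qPochhammer_mul_neg (a : ℂ) {q : ℂ} (hq : ‖q‖ < 1) :
    qPochhammer a q * qPochhammer (-a) q = qPochhammer (a ^ 2) (q ^ 2) := by
  have hQ : ‖q ^ 2‖ < 1 := by
    rw [norm_pow]; exact pow_lt_one₀ (norm_nonneg q) hq two_ne_zero
  refine ((hasProd_qPochhammer a hq).mul (hasProd_qPochhammer (-a) hq)).unique ?_
  convert hasProd_qPochhammer (a ^ 2) hQ using 2 with k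
  ring

theorem thetaSeries_sq_mul_thetaSeries_sq_neg_one {q : ℂ} (hq : ‖q‖ < 1) (hq0 : q ≠ 0) :
    thetaSeries (q ^ 2) q * thetaSeries (q ^ 2) (-1) =
      thetaSeries (q ^ 2) (-q) * thetaSeries q 1 := by
  have hQ : ‖q ^ 2‖ < 1 := by
    rw [norm_pow]; exact pow_lt_one₀ (norm_nonneg q) hq two_ne_zero
  have hQ0 : q ^ 2 ≠ 0 := pow_ne_zero 2 hq0
  rw [thetaSeries_eq_mul hQ hQ0 hq0, thetaSeries_eq_mul hQ hQ0 (neg_ne_zero.mpr one_ne_zero),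
    thetaSeries_eq_mul hQ hQ0 (neg_ne_zero.mpr hq0), thetaSeries_eq_mul hq hq0 one_ne_zero]
  have e1 := qPochhammer_eq_mul q hQ
  have e2 := qPochhammer_eq_mul (-q) hQ
  have e3 := qPochhammer_eq_mul (q ^ 2) hQ
  have e4 := qPochhammer_mul_neg q hQ
  rw [show q * q ^ 2 = q ^ 3 by ring] at e1
  rw [show -q * q ^ 2 = -q ^ 3 by ring] at e2
  rw [show q ^ 2 * q ^ 2 = (q ^ 2) ^ 2 by ring] at e3
  rw [show -(q * q ^ 2) = -q ^ 3 by ring, show -(q⁻¹ * q ^ 2) = -q by field_simp,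
    show -(-1 * q ^ 2) = q ^ 2 by ring, show -((-1)⁻¹ * q ^ 2) = q ^ 2 by norm_num,
    show -(-q * q ^ 2) = q ^ 3 by ring, show -((-q)⁻¹ * q ^ 2) = q by field_simp,
    inv_one, one_mul, e3, mul_comm (qPochhammer (-q ^ 3) _), ← e2,
    mul_comm (qPochhammer (q ^ 3) _), ← e1, ← e4]
  ring

theorem thetaSeries_even_odd {q : ℂ} (hq : ‖q‖ < 1) (hq0 : q ≠ 0) {x y : ℂ}
    (hxy : x * y = -q) (hxy' : x * y⁻¹ = -q) (hx : x ≠ 0) (hy : y ≠ 0) :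
    thetaSeries (q ^ 2) x * thetaSeries (q ^ 2) y =
      thetaSeries (q ^ 4) (-q) ^ 2 + x * thetaSeries (q ^ 4) (-q ^ 3) ^ 2 := by
  have hQ : ‖q ^ 2‖ < 1 := by
    rw [norm_pow]; exact pow_lt_one₀ (norm_nonneg q) hq two_ne_zero
  have hq4 : q ^ 4 ≠ 0 := pow_ne_zero 4 hq0
  have hz : -(q ^ 3)⁻¹ ≠ 0 := neg_ne_zero.mpr (inv_ne_zero (pow_ne_zero 3 hq0))
  have h := thetaSeries_sq_mul hq4 hz
  rw [show (q ^ 4) ^ 2 * -(q ^ 3)⁻¹ = q ^ 4 * -q by field_simp,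
    show (-(q ^ 3)⁻¹)⁻¹ = -q ^ 3 by rw [inv_neg, inv_inv]] at h
  rw [thetaSeries_mul_thetaSeries hQ (pow_ne_zero 2 hq0) hx hy, hxy, hxy',
    show (q ^ 2) ^ 2 = q ^ 4 by ring, h]
  field_simp

theorem thetaSeries_add_mul {q : ℂ} (hq : ‖q‖ < 1) (hq0 : q ≠ 0) :
    (thetaSeries q 1 + thetaSeries (q ^ 2) 1) * thetaSeries (q ^ 2) (-q) =
      2 * thetaSeries (q ^ 4) (-q) ^ 2 := by
  have h1 := thetaSeries_even_odd hq hq0 (x := q) (y := -1) (by ring) (by norm_num) hq0 (by simp)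
  have h2 := thetaSeries_even_odd hq hq0 (x := -q) (y := 1) (by ring) (by norm_num)
    (neg_ne_zero.mpr hq0) one_ne_zero
  rw [thetaSeries_sq_mul_thetaSeries_sq_neg_one hq hq0] at h1
  linear_combination h1 + h2

theorem thetaSeries_sub_mul {q : ℂ} (hq : ‖q‖ < 1) (hq0 : q ≠ 0) :
    (thetaSeries q 1 - thetaSeries (q ^ 2) 1) * thetaSeries (q ^ 2) (-q) =
      2 * (q * thetaSeries (q ^ 4) (-q ^ 3) ^ 2) := by
  have h1 := thetaSeries_even_odd hq hq0 (x := q) (y := -1) (by ring) (by norm_num) hq0 (by simp)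
  have h2 := thetaSeries_even_odd hq hq0 (x := -q) (y := 1) (by ring) (by norm_num)
    (neg_ne_zero.mpr hq0) one_ne_zero
  rw [thetaSeries_sq_mul_thetaSeries_sq_neg_one hq hq0] at h1
  linear_combination h1 - h2

theorem HasProd.one_sub_pow_zpow_chi8 {q : ℂ} (hq : ‖q‖ < 1) :
    HasProd (fun n : ℕ ↦ (1 - q ^ (n + 1)) ^ chi8 (n + 1))
      (qPochhammer q (q ^ 8) * qPochhammer (q ^ 7) (q ^ 8) /
        (qPochhammer (q ^ 3) (q ^ 8) * qPochhammer (q ^ 5) (q ^ 8))) := by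
  have hpow {m : ℕ} (hm : m ≠ 0) : ‖q ^ m‖ < 1 := by
    rw [norm_pow]; exact pow_lt_one₀ (norm_nonneg q) hq hm
  have h8 := hpow (m := 8) (by norm_num)
  obtain ⟨g, hg⟩ : ∃ g : ℕ → ℂ, ∀ n, (1 - q ^ n) ^ chi8 n = g n := ⟨_, fun _ ↦ rfl⟩
  have hpos (r : ℕ) (hr : ∀ k, chi8 (8 * k + r) = 1) :
      HasProd (fun k : ℕ ↦ g (8 * k + r)) (qPochhammer (q ^ r) (q ^ 8)) := by
    convert hasProd_qPochhammer (q ^ r) h8 using 2 with k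
    rw [← hg, hr, zpow_one, pow_add, pow_mul, mul_comm]
  have hneg (r : ℕ) (hr0 : r ≠ 0) (hr : ∀ k, chi8 (8 * k + r) = -1) :
      HasProd (fun k : ℕ ↦ g (8 * k + r)) (qPochhammer (q ^ r) (q ^ 8))⁻¹ := by
    convert! (hasProd_qPochhammer (q ^ r) h8).inv₀ (qPochhammer_ne_zero (hpow hr0) h8) using 2
      with k
    rw [← hg, hr, zpow_neg_one, pow_add, pow_mul, mul_comm]
  have h1 := hpos 1 fun k ↦ by simp only [chi8]; grind
  have h7 := hpos 7 fun k ↦ by simp only [chi8]; grind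
  have h3 := hneg 3 (by norm_num) fun k ↦ by simp only [chi8]; grind
  have h5 := hneg 5 (by norm_num) fun k ↦ by simp only [chi8]; grind
  have hodd : HasProd (fun k : ℕ ↦ g (2 * k + 1 + 1)) 1 := by
    convert hasProd_one (α := ℂ) (β := ℕ) using 2 with k
    rw [← hg, show chi8 (2 * k + 1 + 1) = 0 by simp only [chi8]; grind, zpow_zero]
  have h15 : HasProd (fun k : ℕ ↦ g (2 * (2 * k) + 1))
      (qPochhammer (q ^ 1) (q ^ 8) * (qPochhammer (q ^ 5) (q ^ 8))⁻¹) :=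
    HasProd.even_mul_odd (by convert h1 using 3; ring) (by convert h5 using 3; ring)
  have h37 : HasProd (fun k : ℕ ↦ g (2 * (2 * k + 1) + 1))
      ((qPochhammer (q ^ 3) (q ^ 8))⁻¹ * qPochhammer (q ^ 7) (q ^ 8)) :=
    HasProd.even_mul_odd (by convert h3 using 3; ring) (by convert h7 using 3; ring)
  simp only [hg]
  convert (h15.even_mul_odd (f := fun k ↦ g (2 * k + 1)) h37).even_mul_odd
    (f := fun n ↦ g (n + 1)) hodd using 1
  rw [pow_one]
  field_simp

theorem qpow_natCast_add_one (τ : ℂ) (n : ℕ) : qpow τ ((n : ℝ) + 1) = qpow τ 1 ^ (n + 1) := by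
  rw [qpow, qpow, ← Complex.exp_nat_mul]
  push_cast
  ring_nf

theorem thetaSeries_qpow_one (τ : ℂ) : thetaSeries (qpow τ 1) 1 = jacobiTheta (2 * τ) := by
  rw [thetaSeries, jacobiTheta]
  refine tsum_congr fun j ↦ ?_
  rw [one_zpow, mul_one, qpow, ← Complex.exp_int_mul]
  push_cast
  ring_nf

theorem thetaSeries_qpow_one_sq (τ : ℂ) :
    thetaSeries (qpow τ 1 ^ 2) 1 = jacobiTheta (4 * τ) := by
  have h : qpow τ 1 ^ 2 = qpow (2 * τ) 1 := by
    rw [qpow, qpow, ← Complex.exp_nat_mul]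
    push_cast
    ring_nf
  rw [h, thetaSeries_qpow_one, ← mul_assoc]
  norm_num

/-- Ramanujan's continued fraction as a quotient of theta constants. -/
theorem vRam_sq_mul {τ : ℂ} (hτ : 0 < τ.im) :
    vRam τ ^ 2 * (jacobiTheta (2 * τ) + jacobiTheta (4 * τ)) =
      jacobiTheta (2 * τ) - jacobiTheta (4 * τ) ∧
    jacobiTheta (2 * τ) + jacobiTheta (4 * τ) ≠ 0 := by
  have hq0 : qpow τ 1 ≠ 0 := Complex.exp_ne_zero _
  have hq : ‖qpow τ 1‖ < 1 := by
    simpa [qpow] using UpperHalfPlane.norm_exp_two_pi_I_lt_one ⟨τ, hτ⟩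
  have hsqrt : qpow τ (1 / 2) ^ 2 = qpow τ 1 := by
    rw [qpow, qpow, ← Complex.exp_nat_mul]
    push_cast
    ring_nf
  have hv : vRam τ ^ 2 = qpow τ 1 * (∏' n : ℕ, (1 - qpow τ 1 ^ (n + 1)) ^ chi8 (n + 1)) ^ 2 := by
    rw [vRam, mul_pow, hsqrt]
    simp only [qpow_natCast_add_one]
  rw [hv, ← thetaSeries_qpow_one, ← thetaSeries_qpow_one_sq,
    (HasProd.one_sub_pow_zpow_chi8 hq).tprod_eq]
  generalize qpow τ 1 = q at hq hq0 ⊢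
  have hpow {m : ℕ} (hm : m ≠ 0) : ‖q ^ m‖ < 1 := by
    rw [norm_pow]; exact pow_lt_one₀ (norm_nonneg q) hq hm
  have hne {m n : ℕ} (hm : m ≠ 0) (hn : n ≠ 0) : qPochhammer (q ^ m) (q ^ n) ≠ 0 :=
    qPochhammer_ne_zero (hpow hm) (hpow hn)
  have hψ : thetaSeries (q ^ 2) (-q) ≠ 0 := by
    rw [thetaSeries_eq_mul (hpow two_ne_zero) (pow_ne_zero 2 hq0) (neg_ne_zero.mpr hq0),
      ← pow_mul, show -(-q * q ^ 2) = q ^ 3 by ring,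
      show -((-q)⁻¹ * q ^ 2) = q ^ 1 by field_simp]
    exact mul_ne_zero (hne (by norm_num) (by norm_num))
      (mul_ne_zero (hne (by norm_num) (by norm_num)) (hne (by norm_num) (by norm_num)))
  have hP : thetaSeries (q ^ 4) (-q) = qPochhammer (q ^ 8) (q ^ 8) *
      (qPochhammer (q ^ 5) (q ^ 8) * qPochhammer (q ^ 3) (q ^ 8)) := by
    rw [thetaSeries_eq_mul (hpow four_ne_zero) (pow_ne_zero 4 hq0) (neg_ne_zero.mpr hq0),
      ← pow_mul, show -(-q * q ^ 4) = q ^ 5 by ring,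
      show -((-q)⁻¹ * q ^ 4) = q ^ 3 by field_simp]
  have hR : thetaSeries (q ^ 4) (-q ^ 3) = qPochhammer (q ^ 8) (q ^ 8) *
      (qPochhammer (q ^ 7) (q ^ 8) * qPochhammer q (q ^ 8)) := by
    rw [thetaSeries_eq_mul (hpow four_ne_zero) (pow_ne_zero 4 hq0)
      (neg_ne_zero.mpr (pow_ne_zero 3 hq0)), ← pow_mul, show -(-q ^ 3 * q ^ 4) = q ^ 7 by ring,
      show -((-q ^ 3)⁻¹ * q ^ 4) = q by field_simp]
  have hadd := thetaSeries_add_mul hq hq0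
  have hsub := thetaSeries_sub_mul hq hq0
  have h3 : qPochhammer (q ^ 3) (q ^ 8) ≠ 0 := hne (by norm_num) (by norm_num)
  have h5 : qPochhammer (q ^ 5) (q ^ 8) ≠ 0 := hne (by norm_num) (by norm_num)
  have h8 : qPochhammer (q ^ 8) (q ^ 8) ≠ 0 := hne (by norm_num) (by norm_num)
  rw [hP] at hadd
  rw [hR] at hsub
  constructor
  · refine mul_right_cancel₀ hψ ?_
    rw [mul_assoc, hadd, hsub]
    field_simp
  · intro h
    rw [h, zero_mul] at hadd
    exact mul_ne_zero two_ne_zero (pow_ne_zero 2 (mul_ne_zero h8 (mul_ne_zero h5 h3))) hadd.symm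

theorem jacobiTheta_neg_inv {τ : ℂ} (hτ : 0 < τ.im) :
    jacobiTheta (-τ⁻¹) = (-Complex.I * τ) ^ (1 / 2 : ℂ) * jacobiTheta τ := by
  have h := jacobiTheta_S_smul ⟨τ, hτ⟩
  rw [UpperHalfPlane.modular_S_smul] at h
  simpa [inv_neg] using h

/-- If `τ` lies in the upper half-plane and `σ = -1 + √2`, then
`(X, Y) = (v(τ), v(-1/(8τ)))` lies on the curve `X² + Y² = σ²(1 + X²Y²)`. -/
theorem v_point_on_C2 (τ : ℂ) (hτ : 0 < τ.im) (σ : ℂ) (hσ : σ = -1 + (Real.sqrt 2 : ℂ)) :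
    vRam τ ^ 2 + vRam (-1 / (8 * τ)) ^ 2 =
      σ ^ 2 * (1 + vRam τ ^ 2 * vRam (-1 / (8 * τ)) ^ 2) := by
  have hτ0 : τ ≠ 0 := by rintro rfl; simp at hτ
  have hτ2 : 0 < (2 * τ).im := by simpa using hτ
  have hτ4 : 0 < (4 * τ).im := by simpa using hτ
  have hτ' : 0 < (-1 / (8 * τ)).im := by
    have h := UpperHalfPlane.im_inv_neg_coe_pos ⟨8 * τ, by simpa using hτ⟩
    simpa [neg_div, inv_neg] using h
  obtain ⟨hX, hX0⟩ := vRam_sq_mul hτ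
  obtain ⟨hY, hY0⟩ := vRam_sq_mul hτ'
  have hs : (Real.sqrt 2 : ℂ) ^ 2 = 2 := by
    exact_mod_cast Real.sq_sqrt (zero_le_two (α := ℝ))
  set c : ℂ := (-Complex.I * (2 * τ)) ^ (1 / 2 : ℂ) with hc
  have hIτ : -Complex.I * (2 * τ) ≠ 0 := by simp [hτ0]
  have hc0 : c ≠ 0 := by rw [hc, Ne, Complex.cpow_eq_zero_iff]; tauto
  have hc4 : (-Complex.I * (4 * τ)) ^ (1 / 2 : ℂ) = (Real.sqrt 2 : ℂ) * c := by
    rw [show -Complex.I * (4 * τ) = ((2 : ℝ) : ℂ) * (-Complex.I * (2 * τ)) by push_cast; ring,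
      Complex.cpow_def_of_ne_zero (by simp [hτ0]), Complex.log_ofReal_mul two_pos hIτ, add_mul,
      Complex.exp_add, hc, Complex.cpow_def_of_ne_zero hIτ, Real.sqrt_eq_rpow,
      Complex.ofReal_cpow zero_le_two, Complex.cpow_def_of_ne_zero (by simp),
      Complex.ofReal_log zero_le_two]
    norm_num
  have h2 : jacobiTheta (2 * (-1 / (8 * τ))) = Real.sqrt 2 * c * jacobiTheta (4 * τ) := by
    rw [← hc4, ← jacobiTheta_neg_inv hτ4]
    congr 1
    field_simp
    norm_num
  have h4 : jacobiTheta (4 * (-1 / (8 * τ))) = c * jacobiTheta (2 * τ) := by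
    rw [← jacobiTheta_neg_inv hτ2]
    congr 1
    field_simp
    norm_num
  rw [h2, h4] at hY hY0
  rw [hσ]
  generalize (Real.sqrt 2 : ℂ) = s at *
  generalize vRam τ ^ 2 = X at *
  generalize vRam (-1 / (8 * τ)) ^ 2 = Y at *
  generalize jacobiTheta (2 * τ) = A at *
  generalize jacobiTheta (4 * τ) = B at *
  rw [mul_assoc, mul_left_comm, ← mul_add] at hY0
  have hY0' : s * B + A ≠ 0 := right_ne_zero_of_mul hY0
  have hY' : Y * (s * B + A) = s * B - A := mul_left_cancel₀ hc0 (by linear_combination hY)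
  refine mul_left_cancel₀ (mul_ne_zero hX0 hY0') ?_
  linear_combination (s * B + A) * hX + (A + B) * hY' - (s - 1) ^ 2 * (Y * (s * B + A)) * hX -
    (s - 1) ^ 2 * (A - B) * hY' - 2 * A * B * (s - 1) * hs
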